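/- Consider the $L_\infty$ approximation problem ${\rm APP} = \{{\rm APP}_{\infty,d}\}_{d \in \mathbb{N}}$ over the Korobov spaces with exponential weight $H(K_{d,\mathbf{a},\mathbf{b}})$ in the worst case setting, for either information class $\Lambda \in \{\Lambda^{\rm std}, \Lambda^{\rm all}\}$ and either error criterion $\star \in \{{\rm ABS}, {\rm NOR}\}$. Then ${\rm APP}$ is algebraically uniformly weakly tractable if and only if $\liminf_{j \to \infty} \frac{a_j}{\ln j} \geq \frac{1}{\ln \omega^{-1}}$. -/

import Mathlib

open Filter
open scoped ENNReal NNReal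

noncomputable section

/-- Coefficient space: `ℓ²` sequences indexed by `ℤ^d`.  An element `u` represents the
function `f ∈ H^ω(𝕋^d)` with Fourier coefficients `f̂(k) = u k / ω k`, so that
`‖u‖_{ℓ²} = ‖f‖_{H^ω}`. -/
abbrev Coef (d : ℕ) := lp (fun _ : Fin d → ℤ => ℂ) 2

/-- The periodic function represented by the coefficients `u`:
`f(x) = ∑_{k ∈ ℤ^d} (u k / ω k) e^{2πi k·x}`. -/
def torusFn {d : ℕ} (ω : (Fin d → ℤ) → ℝ) (u : Coef d) (x : Fin d → ℝ) : ℂ :=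
  ∑' k : Fin d → ℤ,
    ((ω k : ℂ))⁻¹ * u k * Complex.exp (2 * Real.pi * Complex.I * ∑ j, (k j : ℂ) * (x j : ℂ))

/-- The torus `𝕋^d`, modelled as the cube `[0,1]^d`. -/
def cube (d : ℕ) : Set (Fin d → ℝ) := {x | ∀ j, x j ∈ Set.Icc (0 : ℝ) 1}

/-- Standard information: point-evaluation functionals `f ↦ f(x)`. -/
def stdInfo {d : ℕ} (ω : (Fin d → ℤ) → ℝ) : Set (Coef d → ℂ) :=
  {L | ∃ x ∈ cube d, L = fun u => torusFn ω u x}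

/-- General linear information: all continuous linear functionals on `H^ω`. -/
def allInfo (d : ℕ) : Set (Coef d → ℂ) := {L | ∃ T : Coef d →L[ℂ] ℂ, L = ⇑T}

/-- The `n`-th minimal worst case error `e(n, APP_{∞,d}; Λ)` of `L_∞`-approximation on the
unit ball of `H^ω(𝕋^d)`, using algorithms `f ↦ φ(L₁ f, …, Lₙ f)` with `Lᵢ ∈ Λ`. -/
def wcErr {d : ℕ} (ω : (Fin d → ℤ) → ℝ) (Λ : Set (Coef d → ℂ)) (n : ℕ) : ℝ≥0∞ :=
  ⨅ (L : Fin n → Coef d → ℂ) (_ : ∀ i, L i ∈ Λ) (φ : (Fin n → ℂ) → (Fin d → ℝ) → ℂ),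
    ⨆ (u : Coef d) (_ : ‖u‖ ≤ 1) (x : Fin d → ℝ) (_ : x ∈ cube d),
      (‖torusFn ω u x - φ (fun i => L i u) x‖₊ : ℝ≥0∞)

/-- The initial error `e(0, APP_{∞,d}) = sup_{‖f‖_{H^ω} ≤ 1} ‖f‖_∞`. -/
def initErr {d : ℕ} (ω : (Fin d → ℤ) → ℝ) : ℝ≥0∞ :=
  ⨆ (u : Coef d) (_ : ‖u‖ ≤ 1) (x : Fin d → ℝ) (_ : x ∈ cube d),
    (‖torusFn ω u x‖₊ : ℝ≥0∞)

/-- The error criterion: absolute (ABS) or normalized (NOR). -/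
inductive Crit | ABS | NOR

/-- `CRI_d`: the normalizing quantity of the error criterion. -/
def CRI {d : ℕ} (ω : (Fin d → ℤ) → ℝ) : Crit → ℝ≥0∞
  | Crit.ABS => 1
  | Crit.NOR => initErr ω

/-- The information complexity `n^⋆(ε, d; Λ)`. -/
def infoComp {d : ℕ} (ω : (Fin d → ℤ) → ℝ) (Λ : Set (Coef d → ℂ)) (crit : Crit) (ε : ℝ) : ℕ :=
  sInf {n : ℕ | wcErr ω Λ n ≤ ENNReal.ofReal ε * CRI ω crit}

/-- Algebraic strong polynomial tractability of the family of information complexities `nc`. -/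
def ALGSPT (nc : ℕ → ℝ → ℕ) : Prop :=
  ∃ C > (0:ℝ), ∃ p ≥ (0:ℝ), ∀ d : ℕ, 0 < d → ∀ ε ∈ Set.Ioo (0:ℝ) 1,
    (nc d ε : ℝ) ≤ C * ε ^ (-p)

/-- The exponent of algebraic strong polynomial tractability. -/
def ALGSPTexp (nc : ℕ → ℝ → ℕ) : ℝ :=
  sInf {p : ℝ | 0 ≤ p ∧ ∃ C > (0:ℝ), ∀ d : ℕ, 0 < d → ∀ ε ∈ Set.Ioo (0:ℝ) 1,
    (nc d ε : ℝ) ≤ C * ε ^ (-p)}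

/-- Algebraic polynomial tractability. -/
def ALGPT (nc : ℕ → ℝ → ℕ) : Prop :=
  ∃ C > (0:ℝ), ∃ p ≥ (0:ℝ), ∃ q ≥ (0:ℝ), ∀ d : ℕ, 0 < d → ∀ ε ∈ Set.Ioo (0:ℝ) 1,
    (nc d ε : ℝ) ≤ C * (d : ℝ) ^ q * ε ^ (-p)

/-- Algebraic quasi-polynomial tractability. -/
def ALGQPT (nc : ℕ → ℝ → ℕ) : Prop :=
  ∃ C > (0:ℝ), ∃ t ≥ (0:ℝ), ∀ d : ℕ, 0 < d → ∀ ε ∈ Set.Ioo (0:ℝ) 1,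
    (nc d ε : ℝ) ≤ C * Real.exp (t * (1 + Real.log d) * (1 + Real.log ε⁻¹))

/-- The exponent of algebraic quasi-polynomial tractability. -/
def ALGQPTexp (nc : ℕ → ℝ → ℕ) : ℝ :=
  sInf {t : ℝ | 0 ≤ t ∧ ∃ C > (0:ℝ), ∀ d : ℕ, 0 < d → ∀ ε ∈ Set.Ioo (0:ℝ) 1,
    (nc d ε : ℝ) ≤ C * Real.exp (t * (1 + Real.log d) * (1 + Real.log ε⁻¹))}

/-- Exponential quasi-polynomial tractability. -/
def EXPQPT (nc : ℕ → ℝ → ℕ) : Prop :=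
  ∃ C > (0:ℝ), ∃ t ≥ (0:ℝ), ∀ d : ℕ, 0 < d → ∀ ε ∈ Set.Ioo (0:ℝ) 1,
    (nc d ε : ℝ) ≤ C * Real.exp (t * (1 + Real.log d) * (1 + Real.log (Real.log ε⁻¹ + 1)))

/-- The exponent of exponential quasi-polynomial tractability. -/
def EXPQPTexp (nc : ℕ → ℝ → ℕ) : ℝ :=
  sInf {t : ℝ | 0 ≤ t ∧ ∃ C > (0:ℝ), ∀ d : ℕ, 0 < d → ∀ ε ∈ Set.Ioo (0:ℝ) 1,
    (nc d ε : ℝ) ≤ C * Real.exp (t * (1 + Real.log d) * (1 + Real.log (Real.log ε⁻¹ + 1)))}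

/-- `lim_{ε⁻¹ + d → ∞} (log nc(d, ε)) / den(d, ε) = 0`. -/
def WTlim (den : ℕ → ℝ → ℝ) (nc : ℕ → ℝ → ℕ) : Prop :=
  ∀ δ > (0:ℝ), ∃ M : ℝ, ∀ d : ℕ, 0 < d → ∀ ε ∈ Set.Ioo (0:ℝ) 1,
    M ≤ ε⁻¹ + d → |Real.log (nc d ε) / den d ε| < δ

/-- Algebraic `(s,t)`-weak tractability; `ALGWTst 1 1` is algebraic weak tractability. -/
def ALGWTst (s t : ℝ) (nc : ℕ → ℝ → ℕ) : Prop :=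
  WTlim (fun d ε => ε ^ (-s) + (d : ℝ) ^ t) nc

/-- Algebraic uniform weak tractability. -/
def ALGUWT (nc : ℕ → ℝ → ℕ) : Prop := ∀ α > (0:ℝ), ∀ β > (0:ℝ), ALGWTst α β nc

/-- Exponential `(s,t)`-weak tractability; `EXPWTst 1 1` is exponential weak tractability. -/
def EXPWTst (s t : ℝ) (nc : ℕ → ℝ → ℕ) : Prop :=
  WTlim (fun d ε => (1 + Real.log ε⁻¹) ^ s + (d : ℝ) ^ t) nc

/-- Exponential uniform weak tractability. -/
def EXPUWT (nc : ℕ → ℝ → ℕ) : Prop := ∀ α > (0:ℝ), ∀ β > (0:ℝ), EXPWTst α β nc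

/-- The weight of the Korobov space with exponential weight `H(K_{d,a,b})`:
`ω_d(h) = ω_h^{-1/2}` where `ω_h = ω^{∑_k a_k |h_k|^{b_k}}` (coordinate `k` uses
`a_{k+1}, b_{k+1}`, the sequences being indexed starting from `1`). -/
def expKorWeight (w : ℝ) (a b : ℕ → ℝ) (d : ℕ) (h : Fin d → ℤ) : ℝ :=
  w ^ (-(∑ j : Fin d, a (j.1 + 1) * (|h j| : ℝ) ^ b (j.1 + 1)) / 2)

/-- The information complexity function of `L_∞`-approximation over the Korobov spaces
with exponential weight, for `Λ^std` (`useStd = true`) or `Λ^all` (`useStd = false`). -/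
def expKorNC (w : ℝ) (a b : ℕ → ℝ) (useStd : Bool) (crit : Crit) : ℕ → ℝ → ℕ := fun d ε =>
  infoComp (expKorWeight w a b d) (if useStd then stdInfo (expKorWeight w a b d) else allInfo d)
    crit ε


/-- The character factor. -/
def chr {d : ℕ} (h : Fin d → ℤ) (x : Fin d → ℝ) : ℂ :=
  Complex.exp (2 * Real.pi * Complex.I * ∑ j, (h j : ℂ) * (x j : ℂ))

lemma chr_norm {d : ℕ} (h : Fin d → ℤ) (x : Fin d → ℝ) : ‖chr h x‖ = 1 := by
  have : (2 * Real.pi * Complex.I * ∑ j, (h j : ℂ) * (x j : ℂ))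
      = ((2 * Real.pi * ∑ j, (h j : ℝ) * (x j : ℝ) : ℝ) : ℂ) * Complex.I := by
    push_cast; ring
  rw [chr, this, Complex.norm_exp_ofReal_mul_I]

lemma kv_mem {d : ℕ} (c : (Fin d → ℤ) → ℝ) (hc : Summable fun h => c h ^ 2) (x : Fin d → ℝ) :
    Memℓp (fun h => (c h : ℂ) * (starRingEnd ℂ) (chr h x)) 2 := by
  apply memℓp_gen
  simpa [chr_norm] using hc

/-- kernel vector. -/
def kv {d : ℕ} (c : (Fin d → ℤ) → ℝ) (hc : Summable fun h => c h ^ 2) (x : Fin d → ℝ) : Coef d :=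
  ⟨fun h => (c h : ℂ) * (starRingEnd ℂ) (chr h x), kv_mem c hc x⟩

lemma kv_apply {d : ℕ} (c : (Fin d → ℤ) → ℝ) (hc : Summable fun h => c h ^ 2) (x : Fin d → ℝ)
    (h : Fin d → ℤ) : kv c hc x h = (c h : ℂ) * (starRingEnd ℂ) (chr h x) := rfl

lemma coef_norm_sq {d : ℕ} (u : Coef d) : ‖u‖ ^ 2 = ∑' h, ‖u h‖ ^ 2 := by
  have := lp.norm_rpow_eq_tsum (p := 2) (by norm_num) u
  simpa using this

lemma kv_norm_sq {d : ℕ} (c : (Fin d → ℤ) → ℝ) (hc : Summable fun h => c h ^ 2)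
    (x : Fin d → ℝ) : ‖kv c hc x‖ ^ 2 = ∑' h, c h ^ 2 := by
  rw [coef_norm_sq]
  simp [kv_apply, chr_norm]

lemma torusFn_eq {d : ℕ} (ω : (Fin d → ℤ) → ℝ) (hc : Summable fun h => (ω h)⁻¹ ^ 2)
    (u : Coef d) (x : Fin d → ℝ) :
    torusFn ω u x = inner ℂ (kv (fun h => (ω h)⁻¹) hc x) u := by
  rw [lp.inner_eq_tsum, torusFn]
  refine tsum_congr fun h => ?_
  simp only [kv_apply, RCLike.inner_apply, map_mul, Complex.conj_conj, Complex.conj_ofReal, chr]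
  push_cast; ring

lemma std_subset_all {d : ℕ} (ω : (Fin d → ℤ) → ℝ) (hc : Summable fun h => (ω h)⁻¹ ^ 2) :
    stdInfo ω ⊆ allInfo d := by
  rintro L ⟨x, -, rfl⟩
  refine ⟨innerSL ℂ (kv (fun h => (ω h)⁻¹) hc x), ?_⟩
  funext u
  rw [torusFn_eq ω hc]; rfl

lemma wcErr_mono {d : ℕ} (ω : (Fin d → ℤ) → ℝ) {Λ Λ' : Set (Coef d → ℂ)} (h : Λ ⊆ Λ') (n : ℕ) :
    wcErr ω Λ' n ≤ wcErr ω Λ n := by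
  unfold wcErr
  refine le_iInf fun L => le_iInf fun hL => ?_
  exact iInf_le_of_le L (iInf_le_of_le (fun i => h (hL i)) le_rfl)

lemma initErr_le {d : ℕ} (ω : (Fin d → ℤ) → ℝ) (hc : Summable fun h => (ω h)⁻¹ ^ 2) :
    initErr ω ≤ ENNReal.ofReal (√(∑' h, (ω h)⁻¹ ^ 2)) := by
  unfold initErr
  refine iSup_le fun u => iSup_le fun hu => iSup_le fun x => iSup_le fun hx => ?_
  rw [← ENNReal.ofReal_coe_nnreal, coe_nnnorm]
  apply ENNReal.ofReal_le_ofReal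
  rw [torusFn_eq ω hc, ← kv_norm_sq _ hc x, Real.sqrt_sq (norm_nonneg _)]
  refine (norm_inner_le_norm _ _).trans ?_
  exact mul_le_of_le_one_right (norm_nonneg _) hu

lemma one_le_initErr {d : ℕ} (ω : (Fin d → ℤ) → ℝ) (h0 : ω 0 = 1) :
    1 ≤ initErr ω := by
  classical
  have hu : ‖(lp.single 2 (0 : Fin d → ℤ) (1:ℂ) : Coef d)‖ ≤ 1 := by
    rw [lp.norm_single (by norm_num)]; simp
  have hx : (fun _ => 0 : Fin d → ℝ) ∈ cube d := fun j => by simp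
  unfold initErr
  refine le_iSup_of_le (lp.single 2 (0 : Fin d → ℤ) (1:ℂ) : Coef d) (le_iSup_of_le hu
    (le_iSup_of_le (fun _ => 0) (le_iSup_of_le hx ?_)))
  have : torusFn ω (lp.single 2 (0 : Fin d → ℤ) (1:ℂ) : Coef d) (fun _ => 0) = 1 := by
    rw [torusFn, tsum_eq_single 0]
    · simp [h0, lp.single_apply_self]
    · intro h hh
      rw [lp.single_apply_ne _ _ _ hh]; simp
  rw [this]; simp

lemma algo_of_span {d : ℕ} (ω : (Fin d → ℤ) → ℝ) (hc : Summable fun h => (ω h)⁻¹ ^ 2)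
    (ε : ℝ) {n : ℕ} (x : Fin n → Fin d → ℝ) (hx : ∀ i, x i ∈ cube d)
    (H : ∀ y ∈ cube d, ∃ v ∈ Submodule.span ℂ (Set.range fun i => kv (fun h => (ω h)⁻¹) hc (x i)),
      ‖kv (fun h => (ω h)⁻¹) hc y - v‖ ≤ ε) :
    wcErr ω (stdInfo ω) n ≤ ENNReal.ofReal ε := by
  classical
  have H' : ∀ y, ∃ c : Fin n → ℂ, y ∈ cube d →
      ‖kv (fun h => (ω h)⁻¹) hc y - ∑ i, c i • kv (fun h => (ω h)⁻¹) hc (x i)‖ ≤ ε := by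
    intro y
    by_cases hy : y ∈ cube d
    · obtain ⟨v, hv, h⟩ := H y hy
      obtain ⟨c, rfl⟩ := (Submodule.mem_span_range_iff_exists_fun ℂ).1 hv
      exact ⟨c, fun _ => h⟩
    · exact ⟨0, fun h => absurd h hy⟩
  choose c hc' using H'
  unfold wcErr
  refine iInf_le_of_le (fun i u => torusFn ω u (x i)) (iInf_le_of_le (fun i => ⟨x i, hx i, rfl⟩)
    (iInf_le_of_le (fun v y => ∑ i, (starRingEnd ℂ) (c y i) * v i) ?_))
  refine iSup_le fun u => iSup_le fun hu => iSup_le fun y => iSup_le fun hy => ?_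
  rw [← ENNReal.ofReal_coe_nnreal, coe_nnnorm]
  apply ENNReal.ofReal_le_ofReal
  have : torusFn ω u y - ∑ i, (starRingEnd ℂ) (c y i) * torusFn ω u (x i)
      = inner ℂ (kv (fun h => (ω h)⁻¹) hc y - ∑ i, c y i • kv (fun h => (ω h)⁻¹) hc (x i)) u := by
    rw [inner_sub_left, sum_inner]
    simp only [inner_smul_left, torusFn_eq ω hc]
  rw [this]
  refine (norm_inner_le_norm _ _).trans ?_
  exact (mul_le_of_le_one_right (norm_nonneg _) hu).trans (hc' y hy)

/-- Gram–Schmidt-type configuration. -/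
def Conf {d : ℕ} (k : (Fin d → ℝ) → Coef d) (ε : ℝ) (n : ℕ) : Prop :=
  ∃ (x : Fin n → Fin d → ℝ) (e : Fin n → Coef d), (∀ i, x i ∈ cube d) ∧ Orthonormal ℂ e ∧
    (∀ i, e i ∈ Submodule.span ℂ (Set.range fun i => k (x i))) ∧
    ∀ i, ε < ‖inner ℂ (e i) (k (x i))‖

lemma conf_step {d : ℕ} (k : (Fin d → ℝ) → Coef d) (ε : ℝ) (hε : 0 < ε) (n : ℕ)
    (hC : Conf k ε n) (hn : ¬ ∃ x : Fin n → Fin d → ℝ, (∀ i, x i ∈ cube d) ∧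
      ∀ y ∈ cube d, ∃ v ∈ Submodule.span ℂ (Set.range fun i => k (x i)), ‖k y - v‖ ≤ ε) :
    Conf k ε (n + 1) := by
  obtain ⟨x, e, hx, he, hes, hi⟩ := hC
  push Not at hn
  obtain ⟨y, hy, hv⟩ := hn x hx
  set W := Submodule.span ℂ (Set.range fun i => k (x i)) with hW
  have : FiniteDimensional ℂ W := FiniteDimensional.span_of_finite ℂ (Set.finite_range _)
  set p : Coef d := W.starProjection (k y) with hp
  have hpW : p ∈ W := W.starProjection_apply_mem _
  have hr : ε < ‖k y - p‖ := hv p hpW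
  have horth : ∀ v ∈ W, inner ℂ v (k y - p) = 0 := by
    intro v hv
    have := W.sub_starProjection_mem_orthogonal (k y)
    exact (Submodule.mem_orthogonal W _).1 this v hv
  have hr0 : (0:ℝ) < ‖k y - p‖ := hε.trans hr
  set z : Coef d := ((‖k y - p‖⁻¹ : ℝ) : ℂ) • (k y - p) with hz
  have hz1 : ‖z‖ = 1 := by
    rw [hz, norm_smul]; simp [hr0.ne']
  have hsub : W ≤ Submodule.span ℂ (Set.range fun i : Fin (n+1) => k (Fin.snoc (α := fun _ => Fin d → ℝ) x y i)) := by
    rw [hW]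
    apply Submodule.span_mono
    rintro _ ⟨i, rfl⟩
    exact ⟨i.castSucc, by simp⟩
  have hez : ∀ i, inner ℂ (e i) z = 0 := by
    intro i
    rw [hz, inner_smul_right, horth _ (hes i), mul_zero]
  refine ⟨Fin.snoc (α := fun _ => Fin d → ℝ) x y, Fin.snoc (α := fun _ => Coef d) e z, ?_, ?_, ?_, ?_⟩
  · intro i
    refine Fin.lastCases ?_ (fun i => ?_) i
    · simpa using hy
    · simpa using hx i
  · rw [orthonormal_iff_ite] at he ⊢
    intro i j
    refine Fin.lastCases ?_ (fun i => ?_) i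
    · refine Fin.lastCases ?_ (fun j => ?_) j
      · simp only [Fin.snoc_last]
        rw [inner_self_eq_norm_sq_to_K, hz1]; simp
      · simp only [Fin.snoc_last, Fin.snoc_castSucc]
        rw [← inner_conj_symm, hez, if_neg (Fin.castSucc_lt_last j).ne']; simp
    · refine Fin.lastCases ?_ (fun j => ?_) j
      · simp only [Fin.snoc_last, Fin.snoc_castSucc]
        rw [hez, if_neg (Fin.castSucc_lt_last i).ne]
      · simp only [Fin.snoc_castSucc]
        rw [he]; simp
  · intro i
    refine Fin.lastCases ?_ (fun i => ?_) i
    · simp only [Fin.snoc_last]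
      rw [hz]
      refine Submodule.smul_mem _ _ (Submodule.sub_mem _ (Submodule.subset_span ⟨Fin.last n, by simp⟩) (hsub hpW))
    · simp only [Fin.snoc_castSucc]
      exact hsub (hes i)
  · intro i
    refine Fin.lastCases ?_ (fun i => ?_) i
    · simp only [Fin.snoc_last]
      have h1 : inner ℂ (k y - p) (k y) = ((‖k y - p‖ ^ 2 : ℝ) : ℂ) := by
        have h2 : inner ℂ (k y - p) p = 0 := by
          rw [← inner_conj_symm, horth p hpW]; simp
        calc inner ℂ (k y - p) (k y) = inner ℂ (k y - p) (k y - p) + inner ℂ (k y - p) p := by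
              rw [← inner_add_right, sub_add_cancel]
          _ = _ := by rw [h2, add_zero, inner_self_eq_norm_sq_to_K]; simp
      rw [hz, inner_smul_left, h1, Complex.conj_ofReal, ← Complex.ofReal_mul, Complex.norm_real]
      rw [Real.norm_of_nonneg (by positivity), pow_two, ← mul_assoc, inv_mul_cancel₀ hr0.ne', one_mul]
      exact hr
    · simp only [Fin.snoc_castSucc]
      exact hi i

lemma conf_bound {d : ℕ} (c : (Fin d → ℤ) → ℝ) (hc : Summable fun h => c h ^ 2) (ε : ℝ)
    (hε : 0 < ε) (A : Finset (Fin d → ℤ))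
    (hA : ∑' h, (if h ∈ A then 0 else c h) ^ 2 ≤ (ε / 2) ^ 2)
    (n : ℕ) (hC : Conf (kv c hc) ε n) :
    n * (ε / 2) ^ 2 ≤ (∑' h, c h ^ 2) * A.card := by
  classical
  obtain ⟨x, e, hx, he, hes, hi⟩ := hC
  have hcA : Summable fun h => (if h ∈ A then 0 else c h) ^ 2 := by
    refine Summable.of_nonneg_of_le (fun _ => sq_nonneg _) (fun h => ?_) hc
    split_ifs <;> simp [sq_nonneg]
  have hS : 0 ≤ ∑' h, c h ^ 2 := tsum_nonneg fun _ => sq_nonneg _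
  have key : ∀ i, (ε / 2) ^ 2 ≤ (∑' h, c h ^ 2) * ∑ h ∈ A, ‖e i h‖ ^ 2 := by
    intro i
    have h1 : inner ℂ (e i) (kv c hc (x i)) = inner ℂ (e i) (kv _ hcA (x i))
        + ∑ h ∈ A, inner ℂ (e i h) (kv c hc (x i) h) := by
      have h2 : (kv c hc (x i)) = kv _ hcA (x i) + ∑ h ∈ A, lp.single 2 h (kv c hc (x i) h) := by
        ext g
        rw [lp.coeFn_add, Pi.add_apply, lp.coeFn_sum, Finset.sum_apply]
        simp only [lp.coeFn_single, Pi.single_apply, kv_apply]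
        by_cases hg : g ∈ A <;> simp [hg]
      conv_lhs => rw [h2]
      rw [inner_add_right, inner_sum]
      simp only [lp.inner_single_right]
    have h3 : ‖inner ℂ (e i) (kv _ hcA (x i))‖ ≤ ε / 2 := by
      refine (norm_inner_le_norm _ _).trans ?_
      rw [he.1 i, one_mul]
      refine abs_le_of_sq_le_sq' ?_ (by positivity) |>.2
      rw [kv_norm_sq]; exact hA
    have h4 : ε / 2 ≤ ‖∑ h ∈ A, inner ℂ (e i h) (kv c hc (x i) h)‖ := by
      have := norm_add_le (inner ℂ (e i) (kv _ hcA (x i))) (∑ h ∈ A, inner ℂ (e i h) (kv c hc (x i) h))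
      rw [← h1] at this
      linarith [hi i]
    have h5 : ‖∑ h ∈ A, inner ℂ (e i h) (kv c hc (x i) h)‖ ≤ ∑ h ∈ A, |c h| * ‖e i h‖ := by
      refine (norm_sum_le _ _).trans (Finset.sum_le_sum fun h _ => ?_)
      refine (norm_inner_le_norm _ _).trans ?_
      rw [kv_apply]; simp [chr_norm, mul_comm]
    calc (ε/2)^2 ≤ (∑ h ∈ A, |c h| * ‖e i h‖)^2 := by
          apply pow_le_pow_left₀ (by positivity) (h4.trans h5)
      _ ≤ (∑ h ∈ A, |c h|^2) * ∑ h ∈ A, ‖e i h‖ ^ 2 := Finset.sum_mul_sq_le_sq_mul_sq _ _ _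
      _ ≤ _ := by
        apply mul_le_mul_of_nonneg_right _ (by positivity)
        simp only [sq_abs]
        exact hc.sum_le_tsum _ (fun _ _ => sq_nonneg _)
  have bes : ∀ h, ∑ i, ‖e i h‖ ^ 2 ≤ 1 := by
    intro h
    have := he.sum_inner_products_le (lp.single 2 h (1:ℂ) : Coef d) (s := Finset.univ)
    rw [lp.norm_single (by norm_num)] at this
    simpa [lp.inner_single_right] using this
  calc n * (ε / 2) ^ 2 = ∑ i : Fin n, (ε / 2) ^ 2 := by simp
    _ ≤ ∑ i : Fin n, (∑' h, c h ^ 2) * ∑ h ∈ A, ‖e i h‖ ^ 2 := Finset.sum_le_sum fun i _ => key i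
    _ = (∑' h, c h ^ 2) * ∑ h ∈ A, ∑ i : Fin n, ‖e i h‖ ^ 2 := by
      rw [← Finset.mul_sum, Finset.sum_comm]
    _ ≤ (∑' h, c h ^ 2) * ∑ h ∈ A, 1 := by
      gcongr with h; exact bes h
    _ = _ := by simp

lemma std_upper {d : ℕ} (ω : (Fin d → ℤ) → ℝ) (hc : Summable fun h => (ω h)⁻¹ ^ 2) (ε : ℝ)
    (hε : 0 < ε) (A : Finset (Fin d → ℤ))
    (hA : ∑' h, (if h ∈ A then 0 else (ω h)⁻¹) ^ 2 ≤ (ε / 2) ^ 2) :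
    ∃ n : ℕ, wcErr ω (stdInfo ω) n ≤ ENNReal.ofReal ε ∧
      n * (ε / 2) ^ 2 ≤ (∑' h, (ω h)⁻¹ ^ 2) * A.card := by
  by_contra! hcon
  have all : ∀ n, Conf (kv (fun h => (ω h)⁻¹) hc) ε n := by
    intro n
    induction n with
    | zero => exact ⟨Fin.elim0, Fin.elim0, fun i => i.elim0, ⟨fun i => i.elim0, fun i => i.elim0⟩,
        fun i => i.elim0, fun i => i.elim0⟩
    | succ n ih =>
      apply conf_step _ _ hε _ ih
      rintro ⟨x, hx, H⟩
      have h1 := hcon n (algo_of_span ω hc ε x hx H)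
      exact absurd (conf_bound _ hc ε hε A hA n ih) (not_le.2 h1)
  obtain ⟨n, hn⟩ := exists_nat_gt ((∑' h, (ω h)⁻¹ ^ 2) * A.card / (ε/2)^2)
  have := conf_bound _ hc ε hε A hA n (all n)
  rw [div_lt_iff₀ (by positivity)] at hn
  linarith

lemma mF_coe {d : ℕ} (h : Fin d → ℤ) (x : Fin d → ℝ) :
    UnitAddTorus.mFourier h (fun j => (x j : UnitAddCircle)) = chr h x := by
  simp only [UnitAddTorus.mFourier, ContinuousMap.coe_mk, fourier_coe_apply, chr]
  rw [← Complex.exp_sum, Finset.mul_sum]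
  congr 1
  refine Finset.sum_congr rfl fun j _ => ?_
  push_cast; ring

/-- Haar probability measure on the torus. -/
def muT (d : ℕ) : MeasureTheory.Measure (UnitAddTorus (Fin d)) :=
  MeasureTheory.Measure.pi (fun _ => AddCircle.haarAddCircle)

instance muT_prob (d : ℕ) : MeasureTheory.IsProbabilityMeasure (muT d) := by
  unfold muT; infer_instance

lemma mF_orth (d : ℕ) : Orthonormal ℂ (fun h : Fin d → ℤ =>
    ContinuousMap.toLp (E := ℂ) 2 (muT d) ℂ (UnitAddTorus.mFourier h)) :=
  UnitAddTorus.orthonormal_mFourier (d := Fin d)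

lemma mF_parseval {d : ℕ} (A : Finset (Fin d → ℤ)) (c : (Fin d → ℤ) → ℂ) :
    ∫ y : UnitAddTorus (Fin d), ‖∑ h ∈ A, c h * UnitAddTorus.mFourier h y‖ ^ 2 ∂(muT d)
      = ∑ h ∈ A, ‖c h‖ ^ 2 := by
  have ho := mF_orth d
  set F : C(UnitAddTorus (Fin d), ℂ) := ∑ h ∈ A, c h • UnitAddTorus.mFourier h with hF
  have h1 := MeasureTheory.ContinuousMap.inner_toLp (𝕜 := ℂ)
    (muT d) F F
  have h2 : ContinuousMap.toLp (E := ℂ) 2 (muT d) ℂ F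
      = ∑ h ∈ A, c h • ContinuousMap.toLp (E := ℂ) 2 (muT d) ℂ (UnitAddTorus.mFourier h) := by
    rw [hF, map_sum]; simp only [map_smul]
  have h4 : ∀ y, F y = ∑ h ∈ A, c h * UnitAddTorus.mFourier h y := by
    intro y; rw [hF, ContinuousMap.coe_sum, Finset.sum_apply]; simp
  rw [h2, ho.inner_sum] at h1
  have h3 : ∀ y, F y * (starRingEnd ℂ) (F y) =
      ((‖∑ h ∈ A, c h * UnitAddTorus.mFourier h y‖ ^ 2 : ℝ) : ℂ) := by
    intro y
    rw [← h4, Complex.mul_conj, Complex.normSq_eq_norm_sq]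
  simp only [h3] at h1
  rw [integral_complex_ofReal] at h1
  apply Complex.ofReal_injective
  rw [← h1]
  push_cast
  refine Finset.sum_congr rfl fun h _ => ?_
  rw [mul_comm, Complex.mul_conj, Complex.normSq_eq_norm_sq]; push_cast; rfl

lemma avg_exists {d n : ℕ} (A : Finset (Fin d → ℤ)) (c : Fin n → (Fin d → ℤ) → ℂ)
    (hc : ∀ i, ∑ h ∈ A, ‖c i h‖ ^ 2 ≤ 1) :
    ∃ x ∈ cube d, ∑ i, ‖∑ h ∈ A, c i h * chr h x‖ ^ 2 ≤ n := by
  have hint : ∀ i, MeasureTheory.Integrable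
      (fun y : UnitAddTorus (Fin d) => ‖∑ h ∈ A, c i h * UnitAddTorus.mFourier h y‖ ^ 2) (muT d) := by
    intro i
    apply Continuous.integrable_of_hasCompactSupport
    · fun_prop
    · exact HasCompactSupport.of_compactSpace _
  obtain ⟨y, hy⟩ := MeasureTheory.exists_le_integral
    (MeasureTheory.integrable_finsetSum Finset.univ (fun i _ => hint i))
  rw [MeasureTheory.integral_finsetSum _ (fun i _ => hint i)] at hy
  have hx : ∀ j, ∃ t ∈ Set.Icc (0:ℝ) 1, (t : UnitAddCircle) = y j := by
    intro j
    have : y j ∈ ((fun t : ℝ => (t : UnitAddCircle)) '' Set.Icc (0:ℝ) (0 + 1)) := by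
      have h := AddCircle.coe_image_Icc_eq (1:ℝ) 0
      rw [h]; trivial
    simpa using this
  choose x hx1 hx2 using hx
  refine ⟨x, hx1, ?_⟩
  have : (fun j => (x j : UnitAddCircle)) = y := funext hx2
  calc ∑ i, ‖∑ h ∈ A, c i h * chr h x‖ ^ 2
      = ∑ i, ‖∑ h ∈ A, c i h * UnitAddTorus.mFourier h y‖ ^ 2 := by
        simp only [← mF_coe, this]
    _ ≤ _ := hy
    _ ≤ ∑ i : Fin n, (1:ℝ) := Finset.sum_le_sum fun i _ => by rw [mF_parseval]; exact hc i
    _ = n := by simp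

/-- Embedding of finitely supported coefficients. -/
def emb {d : ℕ} (A : Finset (Fin d → ℤ)) : EuclideanSpace ℂ A →ₗ[ℂ] Coef d := by
  classical
  exact
  { toFun := fun v => ∑ h : A, lp.single 2 (h : Fin d → ℤ) (v h)
    map_add' := fun u v => by
      rw [← Finset.sum_add_distrib]
      refine Finset.sum_congr rfl fun h _ => ?_
      rw [← lp.single_add]; rfl
    map_smul' := fun c v => by
      rw [Finset.smul_sum]
      refine Finset.sum_congr rfl fun h _ => ?_
      rw [← lp.single_smul]; rfl }

lemma emb_apply {d : ℕ} (A : Finset (Fin d → ℤ)) (v : EuclideanSpace ℂ A) (h : A) :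
    emb A v h = v h := by
  classical
  change (∑ h : A, lp.single 2 (h : Fin d → ℤ) (v h) : Coef d) h = v h
  rw [lp.coeFn_sum, Finset.sum_apply, Finset.sum_eq_single h]
  · simp
  · intro g _ hg
    exact lp.single_apply_ne _ _ _ (fun e => hg (Subtype.ext e.symm))
  · simp

lemma emb_apply_not {d : ℕ} (A : Finset (Fin d → ℤ)) (v : EuclideanSpace ℂ A) (h : Fin d → ℤ)
    (hh : h ∉ A) : emb A v h = 0 := by
  classical
  change (∑ h : A, lp.single 2 (h : Fin d → ℤ) (v h) : Coef d) h = 0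
  rw [lp.coeFn_sum, Finset.sum_apply]
  refine Finset.sum_eq_zero fun g _ => lp.single_apply_ne _ _ _ ?_
  rintro rfl; exact hh g.2

lemma emb_norm {d : ℕ} (A : Finset (Fin d → ℤ)) (v : EuclideanSpace ℂ A) : ‖emb A v‖ = ‖v‖ := by
  have : ‖emb A v‖ ^ 2 = ‖v‖ ^ 2 := by
    rw [coef_norm_sq, EuclideanSpace.norm_sq_eq, tsum_eq_sum (s := A), ← Finset.sum_coe_sort]
    · exact Finset.sum_congr rfl fun h _ => by rw [emb_apply]
    · intro h hh; rw [emb_apply_not A v h hh]; simp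
  exact (sq_eq_sq₀ (norm_nonneg _) (norm_nonneg _)).1 this

/-- finite kernel. -/
def kA {d : ℕ} (ω : (Fin d → ℤ) → ℝ) (A : Finset (Fin d → ℤ)) (x : Fin d → ℝ) :
    EuclideanSpace ℂ A :=
  WithLp.toLp 2 (fun h : A => ((ω h : ℂ))⁻¹ * (starRingEnd ℂ) (chr h x))

lemma torusFn_emb {d : ℕ} (ω : (Fin d → ℤ) → ℝ) (A : Finset (Fin d → ℤ))
    (v : EuclideanSpace ℂ A) (x : Fin d → ℝ) :
    torusFn ω (emb A v) x = inner ℂ (kA ω A x) v := by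
  rw [torusFn, tsum_eq_sum (s := A), ← Finset.sum_coe_sort, PiLp.inner_apply]
  · refine Finset.sum_congr rfl fun h _ => ?_
    rw [emb_apply]
    simp only [kA, RCLike.inner_apply, map_mul, map_inv₀, Complex.conj_conj, Complex.conj_ofReal, chr]
    ring
  · intro h hh; rw [emb_apply_not A v h hh]; simp

lemma kA_norm {d : ℕ} (ω : (Fin d → ℤ) → ℝ) (A : Finset (Fin d → ℤ)) (x : Fin d → ℝ) :
    ‖kA ω A x‖ ^ 2 = ∑ h ∈ A, (ω h)⁻¹ ^ 2 := by
  rw [EuclideanSpace.norm_sq_eq, ← Finset.sum_coe_sort A]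
  refine Finset.sum_congr rfl fun h _ => ?_
  simp [kA, chr_norm]

lemma lower_all {d : ℕ} (ω : (Fin d → ℤ) → ℝ) (hω : ∀ h, 1 ≤ ω h) (A : Finset (Fin d → ℤ))
    (n : ℕ) :
    ENNReal.ofReal (√(∑ h ∈ A, (ω h)⁻¹ ^ 2 - n)) ≤ wcErr ω (allInfo d) n := by
  unfold wcErr
  refine le_iInf fun L => le_iInf fun hL => le_iInf fun φ => ?_
  choose T hT using hL
  let Φ : EuclideanSpace ℂ A →ₗ[ℂ] (Fin n → ℂ) :=
    LinearMap.pi fun i => (T i : Coef d →ₗ[ℂ] ℂ) ∘ₗ emb A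
  set Z : Submodule ℂ (EuclideanSpace ℂ A) := LinearMap.ker Φ with hZ
  set m := Module.finrank ℂ Zᗮ with hm
  have hmn : m ≤ n := by
    have h1 := Φ.finrank_range_add_finrank_ker
    have h2 := Submodule.finrank_add_finrank_orthogonal Z
    have h3 : Module.finrank ℂ (LinearMap.range Φ) ≤ n := by
      simpa using Submodule.finrank_le (LinearMap.range Φ)
    rw [← hZ] at h1
    omega
  let e := stdOrthonormalBasis ℂ Zᗮ
  obtain ⟨x, hx, hle⟩ := avg_exists (n := m) A
    (fun i h => if hh : h ∈ A then ((ω h : ℂ))⁻¹ * (e i : EuclideanSpace ℂ A) ⟨h, hh⟩ else 0) (by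
      intro i
      have h1 : ‖(e i : EuclideanSpace ℂ A)‖ ^ 2 = 1 := by
        have := e.orthonormal.1 i
        rw [← Submodule.coe_norm] at *
        rw [this]; norm_num
      rw [EuclideanSpace.norm_sq_eq] at h1
      rw [← Finset.sum_coe_sort, ← h1]
      refine Finset.sum_le_sum fun h _ => ?_
      rw [dif_pos h.2, norm_mul, mul_pow]
      apply mul_le_of_le_one_left (by positivity)
      have h0 := hω h
      rw [norm_inv, Complex.norm_real, Real.norm_of_nonneg (by linarith)]
      apply pow_le_one₀ (by positivity)
      exact inv_le_one_of_one_le₀ h0)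
  set k := kA ω A x with hk
  have hle' : ‖Zᗮ.starProjection k‖ ^ 2 ≤ n := by
    have h1 : ‖Zᗮ.starProjection k‖ ^ 2 = ∑ i, ‖inner ℂ k (e i : EuclideanSpace ℂ A)‖ ^ 2 := by
      have h2 := e.sum_sq_norm_inner_right (Zᗮ.orthogonalProjectionOnto k)
      rw [Submodule.starProjection_apply, ← Submodule.coe_norm, ← h2]
      refine Finset.sum_congr rfl fun i _ => ?_
      rw [Submodule.inner_orthogonalProjectionOnto_eq_of_mem_left, norm_inner_symm]
    rw [h1]
    refine le_trans (le_of_eq ?_) (hle.trans (by exact_mod_cast hmn))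
    refine Finset.sum_congr rfl fun i _ => ?_
    congr 2
    rw [hk, ← torusFn_emb, torusFn, tsum_eq_sum (s := A)]
    · refine Finset.sum_congr rfl fun h hh => ?_
      rw [dif_pos hh, emb_apply A _ ⟨h, hh⟩]; rfl
    · intro h hh; rw [emb_apply_not A _ h hh]; simp
  set v := Z.starProjection k with hv
  have hpyth : ‖k‖ ^ 2 = ‖v‖ ^ 2 + ‖Zᗮ.starProjection k‖ ^ 2 :=
    Submodule.norm_sq_eq_add_norm_sq_starProjection k Z
  rw [hk, kA_norm] at hpyth
  have hsq : √(∑ h ∈ A, (ω h)⁻¹ ^ 2 - n) ≤ ‖v‖ := by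
    rw [Real.sqrt_le_left (norm_nonneg _)]
    rw [← hk] at hpyth
    linarith
  refine (ENNReal.ofReal_le_ofReal hsq).trans ?_
  by_cases hv0 : ‖v‖ = 0
  · rw [hv0]; simp
  set q : EuclideanSpace ℂ A := ((‖v‖⁻¹ : ℝ) : ℂ) • v with hq
  have hq1 : ‖q‖ = 1 := by rw [hq, norm_smul]; simp [hv0]
  have hqZ : q ∈ Z := Submodule.smul_mem _ _ (Z.starProjection_apply_mem _)
  have hkv : inner ℂ k q = (‖v‖ : ℂ) := by
    rw [hq, inner_smul_right]
    have : inner ℂ k v = ((‖v‖ ^ 2 : ℝ) : ℂ) := by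
      have h1 : inner ℂ (k - v) v = 0 := 
        Submodule.starProjection_inner_eq_zero (K := Z) k v (Z.starProjection_apply_mem _)
      rw [inner_sub_left, sub_eq_zero] at h1
      rw [h1, inner_self_eq_norm_sq_to_K]; simp
    rw [this, ← Complex.ofReal_mul, pow_two, ← mul_assoc, inv_mul_cancel₀ hv0, one_mul]
  have hL0 : ∀ q ∈ Z, (fun i => L i (emb A q)) = 0 := by
    intro q hq
    have : Φ q = 0 := hq
    funext i
    rw [hT i]
    exact congrFun this i
  have f1 : torusFn ω (emb A q) x = (‖v‖ : ℂ) := by rw [torusFn_emb, ← hk, hkv]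
  have f2 : torusFn ω (emb A (-q)) x = -(‖v‖ : ℂ) := by
    rw [torusFn_emb, ← hk, inner_neg_right, hkv]
  have key : ‖v‖ ≤ ‖torusFn ω (emb A q) x - φ 0 x‖ ∨ ‖v‖ ≤ ‖torusFn ω (emb A (-q)) x - φ 0 x‖ := by
    by_contra! hcon
    rw [f1, f2] at hcon
    have h1 := norm_sub_le ((‖v‖ : ℂ) - φ 0 x) (-(‖v‖ : ℂ) - φ 0 x)
    have h2 : ((‖v‖ : ℂ) - φ 0 x) - (-(‖v‖ : ℂ) - φ 0 x) = ((2 * ‖v‖ : ℝ) : ℂ) := by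
      push_cast; ring
    rw [h2, Complex.norm_real, Real.norm_of_nonneg (by positivity)] at h1
    linarith [hcon.1, hcon.2]
  have fin : ∀ q ∈ Z, ‖q‖ ≤ 1 → ‖v‖ ≤ ‖torusFn ω (emb A q) x - φ 0 x‖ →
      ENNReal.ofReal ‖v‖ ≤ ⨆ (u : Coef d) (_ : ‖u‖ ≤ 1) (x : Fin d → ℝ) (_ : x ∈ cube d),
      (‖torusFn ω u x - φ (fun i => L i u) x‖₊ : ℝ≥0∞) := by
    intro q hqZ hq1 hle
    refine le_iSup_of_le (emb A q) (le_iSup_of_le (by rw [emb_norm]; exact hq1)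
      (le_iSup_of_le x (le_iSup_of_le hx ?_)))
    rw [hL0 q hqZ, ← ENNReal.ofReal_coe_nnreal, coe_nnnorm]
    exact ENNReal.ofReal_le_ofReal hle
  rcases key with h | h
  · exact fin q hqZ hq1.le h
  · exact fin (-q) (Submodule.neg_mem _ hqZ) (by rw [norm_neg]; exact hq1.le) h

lemma upper_general {d : ℕ} (ω : (Fin d → ℤ) → ℝ) (hω : ∀ h, 1 ≤ ω h) (p B : ℝ) (hp0 : 0 < p)
    (hp1 : p < 1) (hB : 1 ≤ B)
    (hsum : ∀ F : Finset (Fin d → ℤ), ∑ h ∈ F, ((ω h)⁻¹ ^ 2) ^ p ≤ B)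
    (ε : ℝ) (hε0 : 0 < ε) (hε1 : ε < 1) :
    ∃ n : ℕ, wcErr ω (stdInfo ω) n ≤ ENNReal.ofReal ε ∧
      (n : ℝ) ≤ (4 * B / ε ^ 2) ^ (2 + p / (1 - p)) := by
  classical
  set r : (Fin d → ℤ) → ℝ := fun h => (ω h)⁻¹ ^ 2 with hr
  have hr0 : ∀ h, 0 < r h := fun h => by have := hω h; simp only [hr]; positivity
  have hr1 : ∀ h, r h ≤ 1 := fun h => by
    have := hω h
    exact pow_le_one₀ (by positivity) (inv_le_one_of_one_le₀ this)
  have hsp : Summable fun h => r h ^ p :=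
    summable_of_sum_le (fun h => Real.rpow_nonneg (hr0 h).le _) hsum
  have htp : ∑' h, r h ^ p ≤ B := hsp.tsum_le_of_sum_le hsum
  have hrp : ∀ h, r h ≤ r h ^ p := fun h => by
    conv_lhs => rw [← Real.rpow_one (r h)]
    exact Real.rpow_le_rpow_of_exponent_ge (hr0 h) (hr1 h) hp1.le
  have hs : Summable r := Summable.of_nonneg_of_le (fun h => (hr0 h).le) hrp hsp
  have ht : ∑' h, r h ≤ B := (hs.tsum_le_tsum hrp hsp).trans htp
  set X : ℝ := 4 * B / ε ^ 2 with hX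
  have hX1 : 1 ≤ X := by
    rw [hX, le_div_iff₀ (by positivity)]
    nlinarith
  have hX0 : 0 < X := by linarith
  have hp1' : 0 < 1 - p := by linarith
  set T : ℝ := X ^ (-(1 / (1 - p))) with hT
  have hT0 : 0 < T := Real.rpow_pos_of_pos hX0 _
  have hTp : T ^ (1 - p) = X⁻¹ := by
    rw [hT, ← Real.rpow_mul hX0.le, ← Real.rpow_neg_one]; congr 1; field_simp
  have hTp2 : T ^ p = (X ^ (p / (1 - p)))⁻¹ := by
    rw [hT, ← Real.rpow_mul hX0.le, ← Real.rpow_neg hX0.le]; congr 1; field_simp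
  have hfin : {h | T ≤ r h}.Finite := by
    have h1 := hs.tendsto_cofinite_zero.eventually (gt_mem_nhds hT0)
    rw [Filter.eventually_cofinite] at h1
    refine h1.subset fun h hh => ?_
    simpa using hh
  set A := hfin.toFinset with hA
  have hmem : ∀ h, h ∈ A ↔ T ≤ r h := fun h => by simp [hA]
  have htail : ∑' h, (if h ∈ A then 0 else (ω h)⁻¹) ^ 2 ≤ (ε / 2) ^ 2 := by
    have hle : ∀ h, (if h ∈ A then 0 else (ω h)⁻¹) ^ 2 ≤ r h ^ p * X⁻¹ := by
      intro h
      split_ifs with hh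
      · have := hr0 h; simp; positivity
      · rw [hmem, not_le] at hh
        change r h ≤ _
        calc r h = r h ^ p * r h ^ (1 - p) := by
              rw [← Real.rpow_add (hr0 h)]; simp
          _ ≤ r h ^ p * T ^ (1 - p) := by
              gcongr
          _ = _ := by rw [hTp]
    have hsX := hsp.mul_right X⁻¹
    calc _ ≤ ∑' h, r h ^ p * X⁻¹ :=
          (Summable.of_nonneg_of_le (fun _ => sq_nonneg _) hle hsX).tsum_le_tsum hle hsX
      _ = (∑' h, r h ^ p) * X⁻¹ := tsum_mul_right
      _ ≤ B * X⁻¹ := by gcongr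
      _ = (ε / 2) ^ 2 := by rw [hX]; field_simp; norm_num
  obtain ⟨n, hn1, hn2⟩ := std_upper ω hs ε hε0 A htail
  refine ⟨n, hn1, ?_⟩
  have hcard : (A.card : ℝ) * T ^ p ≤ B := by
    calc (A.card : ℝ) * T ^ p = ∑ h ∈ A, T ^ p := by simp
      _ ≤ ∑ h ∈ A, r h ^ p := Finset.sum_le_sum fun h hh =>
          Real.rpow_le_rpow hT0.le ((hmem h).1 hh) hp0.le
      _ ≤ B := hsum A
  set Y := X ^ (p / (1 - p)) with hY
  have hY0 : 0 < Y := Real.rpow_pos_of_pos hX0 _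
  have hcard2 : (A.card : ℝ) ≤ B * Y := by
    rw [hTp2, ← div_eq_mul_inv, div_le_iff₀ hY0] at hcard; exact hcard
  have h3 : n * (ε / 2) ^ 2 ≤ B * (B * Y) := by
    refine hn2.trans ?_
    gcongr
  rw [Real.rpow_add hX0, ← hY]
  have h4 : X ^ (2:ℝ) = X ^ 2 := by norm_num
  rw [h4]
  have h5 : (n:ℝ) ≤ 4 * B ^ 2 / ε ^ 2 * Y := by
    rw [div_mul_eq_mul_div, le_div_iff₀ (by positivity)]
    nlinarith
  refine h5.trans ?_
  gcongr
  rw [hX, div_pow]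
  rw [div_le_div_iff₀ (by positivity) (by positivity)]
  have : ε ^ 2 ≤ 1 := pow_le_one₀ hε0.le hε1.le
  have h6 : 0 ≤ B ^ 2 * ε ^ 2 := by positivity
  nlinarith

lemma summable_1d (w : ℝ) (hw : w ∈ Set.Ioo (0:ℝ) 1) (l c : ℝ) (hl : 0 < l) (hc : 0 < c) :
    Summable fun m : ℤ => w ^ (l * (|(m:ℝ)| ^ c - 1)) := by
  have hnat : Summable fun n : ℕ => w ^ (l * ((n:ℝ) ^ c - 1)) := by
    have hlog : 0 < -Real.log w := by have := Real.log_neg hw.1 hw.2; linarith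
    have h1 := isLittleO_exp_neg_mul_rpow_atTop (a := l * (-Real.log w)) (by positivity) (-2 / c)
    have h2 : Tendsto (fun n : ℕ => (n:ℝ) ^ c) atTop atTop :=
      (tendsto_rpow_atTop hc).comp tendsto_natCast_atTop_atTop
    have h3 := h1.comp_tendsto h2
    have h4 : Summable fun n : ℕ => ((n:ℝ) ^ c) ^ (-2 / c) := by
      have : (fun n : ℕ => ((n:ℝ) ^ c) ^ (-2 / c)) = fun n : ℕ => (n:ℝ) ^ (-2:ℝ) := by
        funext n
        rw [← Real.rpow_mul (by positivity)]; congr 1; field_simp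
      rw [this]
      exact Real.summable_nat_rpow.2 (by norm_num)
    have h5 := summable_of_isBigO_nat h4 h3.isBigO
    have h6 := h5.mul_left (w ^ (-l))
    refine h6.congr fun n => ?_
    rw [Real.rpow_def_of_pos hw.1, Real.rpow_def_of_pos hw.1, Function.comp, ← Real.exp_add]
    congr 1; ring
  refine Summable.of_nat_of_neg ?_ ?_
  · simpa using hnat
  · simpa using hnat

lemma sum_1d (w : ℝ) (hw : w ∈ Set.Ioo (0:ℝ) 1)
    (a b : ℕ → ℝ) (hapos : 0 < a 1) (hamono : ∀ j, 1 ≤ j → a 1 ≤ a j)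
    (hb : ∃ c > (0:ℝ), ∀ j, 1 ≤ j → c ≤ b j) (p : ℝ) (hp : 0 < p) :
    ∃ D ≥ (0:ℝ), ∀ j, 1 ≤ j → ∀ F : Finset ℤ,
      ∑ m ∈ F, w ^ (p * (a j * |(m:ℝ)| ^ b j)) ≤ 1 + D * w ^ (p * a j) := by
  obtain ⟨c, hc, hcb⟩ := hb
  have hs := summable_1d w hw (p * a 1) c (by positivity) hc
  refine ⟨∑' m : ℤ, w ^ (p * a 1 * (|(m:ℝ)| ^ c - 1)), tsum_nonneg fun m => Real.rpow_nonneg hw.1.le _, fun j hj F => ?_⟩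
  have key : ∀ m : ℤ, w ^ (p * (a j * |(m:ℝ)| ^ b j)) ≤
      (if m = 0 then 1 else 0) + w ^ (p * a 1 * (|(m:ℝ)| ^ c - 1)) * w ^ (p * a j) := by
    intro m
    have hbj : 0 < b j := hc.trans_le (hcb j hj)
    split_ifs with hm
    · subst hm
      have h1 : 0 ≤ w ^ (p * a 1 * (|((0:ℤ):ℝ)| ^ c - 1)) * w ^ (p * a j) :=
        mul_nonneg (Real.rpow_nonneg hw.1.le _) (Real.rpow_nonneg hw.1.le _)
      simp only [Int.cast_zero, abs_zero] at h1 ⊢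
      rw [Real.zero_rpow hbj.ne']
      simp only [mul_zero, Real.rpow_zero]
      linarith
    · rw [zero_add, ← Real.rpow_add hw.1]
      apply Real.rpow_le_rpow_of_exponent_ge hw.1 hw.2.le
      have h1 : (1:ℝ) ≤ |(m:ℝ)| := by exact_mod_cast Int.one_le_abs hm
      have h2 : |(m:ℝ)| ^ c ≤ |(m:ℝ)| ^ b j := Real.rpow_le_rpow_of_exponent_le h1 (hcb j hj)
      have h3 : 1 ≤ |(m:ℝ)| ^ c := Real.one_le_rpow h1 hc.le
      have h4 : a 1 * (|(m:ℝ)| ^ c - 1) ≤ a j * (|(m:ℝ)| ^ b j - 1) :=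
        mul_le_mul (hamono j hj) (by linarith) (by linarith) (hapos.le.trans (hamono j hj))
      nlinarith
  calc _ ≤ ∑ m ∈ F, ((if m = 0 then (1:ℝ) else 0)
        + w ^ (p * a 1 * (|(m:ℝ)| ^ c - 1)) * w ^ (p * a j)) := Finset.sum_le_sum fun m _ => key m
    _ = ∑ m ∈ F, (if m = 0 then (1:ℝ) else 0)
        + (∑ m ∈ F, w ^ (p * a 1 * (|(m:ℝ)| ^ c - 1))) * w ^ (p * a j) := by
        rw [Finset.sum_add_distrib, Finset.sum_mul]
    _ ≤ _ := by
        gcongr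
        · rw [Finset.sum_ite_eq']; split_ifs <;> norm_num
        · exact Real.rpow_nonneg hw.1.le _
        · exact hs.sum_le_tsum _ (fun _ _ => Real.rpow_nonneg hw.1.le _)

lemma kor_sq (w : ℝ) (hw : w ∈ Set.Ioo (0:ℝ) 1) (a b : ℕ → ℝ) (d : ℕ) (h : Fin d → ℤ) (p : ℝ) :
    ((expKorWeight w a b d h)⁻¹ ^ 2) ^ p =
      ∏ j : Fin d, w ^ (p * (a (j.1 + 1) * |(h j : ℝ)| ^ b (j.1 + 1))) := by
  rw [← Real.rpow_sum_of_pos hw.1, ← Finset.mul_sum, expKorWeight, ← Real.rpow_neg hw.1.le,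
    ← Real.rpow_natCast, ← Real.rpow_mul hw.1.le, ← Real.rpow_mul hw.1.le]
  congr 1
  push_cast
  ring

lemma kor_ge_one (w : ℝ) (hw : w ∈ Set.Ioo (0:ℝ) 1) (a b : ℕ → ℝ)
    (ha : ∀ j, 1 ≤ j → 0 < a j) (d : ℕ) (h : Fin d → ℤ) :
    1 ≤ expKorWeight w a b d h := by
  rw [expKorWeight]
  apply Real.one_le_rpow_of_pos_of_le_one_of_nonpos hw.1 hw.2.le
  have : 0 ≤ ∑ j : Fin d, a (j.1 + 1) * (|h j| : ℝ) ^ b (j.1 + 1) :=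
    Finset.sum_nonneg fun j _ => mul_nonneg (ha _ (by omega)).le (Real.rpow_nonneg (by positivity) _)
  linarith

lemma kor_zero (w : ℝ) (a b : ℕ → ℝ) (hb : ∀ j, 1 ≤ j → 0 < b j) (d : ℕ) :
    expKorWeight w a b d 0 = 1 := by
  rw [expKorWeight]
  have : ∑ j : Fin d, a (j.1 + 1) * (|((0 : Fin d → ℤ) j : ℝ)| : ℝ) ^ b (j.1 + 1) = 0 :=
    Finset.sum_eq_zero fun j _ => by
      simp [Real.zero_rpow (hb (j.1+1) (by omega)).ne']
  rw [this]; simp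

lemma kor_sum (w : ℝ) (hw : w ∈ Set.Ioo (0:ℝ) 1)
    (a b : ℕ → ℝ) (hapos : 0 < a 1) (hamono : ∀ j, 1 ≤ j → a 1 ≤ a j)
    (hb : ∃ c > (0:ℝ), ∀ j, 1 ≤ j → c ≤ b j) (p : ℝ) (hp : 0 < p) :
    ∃ D ≥ (0:ℝ), ∀ d : ℕ, ∀ F : Finset (Fin d → ℤ),
      ∑ h ∈ F, ((expKorWeight w a b d h)⁻¹ ^ 2) ^ p ≤
        Real.exp (D * ∑ j : Fin d, w ^ (p * a (j.1 + 1))) := by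
  classical
  obtain ⟨D, hD, H⟩ := sum_1d w hw a b hapos hamono hb p hp
  refine ⟨D, hD, fun d F => ?_⟩
  simp only [kor_sq w hw]
  have hsub : F ⊆ Fintype.piFinset (fun j : Fin d => F.image (fun h => h j)) := by
    intro h hh
    rw [Fintype.mem_piFinset]
    exact fun j => Finset.mem_image_of_mem _ hh
  calc _ ≤ ∑ h ∈ Fintype.piFinset (fun j : Fin d => F.image (fun h => h j)),
        ∏ j : Fin d, w ^ (p * (a (j.1 + 1) * |(h j : ℝ)| ^ b (j.1 + 1))) :=
        Finset.sum_le_sum_of_subset_of_nonneg hsub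
          (fun _ _ _ => Finset.prod_nonneg fun _ _ => Real.rpow_nonneg hw.1.le _)
    _ = ∏ j : Fin d, ∑ m ∈ F.image (fun h => h j),
          w ^ (p * (a (j.1 + 1) * |(m : ℝ)| ^ b (j.1 + 1))) :=
        (Finset.prod_univ_sum (fun j : Fin d => F.image (fun h => h j))
          (fun j m => w ^ (p * (a (j.1 + 1) * |(m : ℝ)| ^ b (j.1 + 1))))).symm
    _ ≤ ∏ j : Fin d, Real.exp (D * w ^ (p * a (j.1 + 1))) := by
        refine Finset.prod_le_prod (fun j _ => Finset.sum_nonneg fun _ _ => Real.rpow_nonneg hw.1.le _)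
          fun j _ => ?_
        refine (H (j.1+1) (by omega) _).trans ?_
        rw [add_comm]
        exact Real.add_one_le_exp _
    _ = _ := by rw [← Real.exp_sum, Finset.mul_sum]

lemma kor_lower (w : ℝ) (hw : w ∈ Set.Ioo (0:ℝ) 1)
    (a b : ℕ → ℝ) (hamono : ∀ i j, 1 ≤ i → i ≤ j → a i ≤ a j) (hapos : 0 < a 1)
    (hb : ∀ j, 1 ≤ j → 0 < b j) (d : ℕ)
    (hs : Summable fun h => (expKorWeight w a b d h)⁻¹ ^ 2) :
    Real.exp (d * w ^ (a d)) ≤ ∑' h, (expKorWeight w a b d h)⁻¹ ^ 2 := by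
  classical
  have h1 : ∑ h ∈ Fintype.piFinset (fun _ : Fin d => ({0, 1, -1} : Finset ℤ)),
      (expKorWeight w a b d h)⁻¹ ^ 2 ≤ ∑' h, (expKorWeight w a b d h)⁻¹ ^ 2 :=
    hs.sum_le_tsum _ (fun _ _ => sq_nonneg _)
  refine le_trans ?_ h1
  have h2 : ∀ h : Fin d → ℤ, (expKorWeight w a b d h)⁻¹ ^ 2 =
      ∏ j : Fin d, w ^ (1 * (a (j.1 + 1) * |(h j : ℝ)| ^ b (j.1 + 1))) := fun h => by
    rw [← kor_sq w hw, Real.rpow_one]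
  simp only [h2]
  rw [← Finset.prod_univ_sum (fun _ : Fin d => ({0, 1, -1} : Finset ℤ))
          (fun j m => w ^ (1 * (a (j.1 + 1) * |(m : ℝ)| ^ b (j.1 + 1))))]
  calc Real.exp (d * w ^ (a d)) = ∏ j : Fin d, Real.exp (w ^ a d) := by
        rw [← Real.exp_sum]; simp
    _ ≤ _ := by
        refine Finset.prod_le_prod (fun _ _ => (Real.exp_pos _).le) fun j _ => ?_
        rw [Finset.sum_insert (by decide), Finset.sum_insert (by decide), Finset.sum_singleton]
        have hbj := hb (j.1 + 1) (by omega)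
        simp only [Int.cast_zero, abs_zero, Real.zero_rpow hbj.ne', mul_zero, Real.rpow_zero,
          Int.cast_one, abs_one, Real.one_rpow, mul_one, one_mul, Int.cast_neg, abs_neg]
        have hle : w ^ a d ≤ w ^ a (j.1 + 1) :=
          Real.rpow_le_rpow_of_exponent_ge hw.1 hw.2.le (hamono _ _ (by omega) (by omega))
        set t := w ^ a d with ht
        have ht0 : 0 ≤ t := Real.rpow_nonneg hw.1.le _
        have had : 0 < a d := hapos.trans_le (hamono _ _ le_rfl (by have := j.2; omega))
        have ht1 : t ≤ 1 := Real.rpow_le_one hw.1.le hw.2.le had.le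
        have h3 : Real.exp t ≤ 1 + 2 * t := by
          have h4 := Real.exp_bound' (x := t) ht0 ht1 (n := 2) (by norm_num)
          norm_num [Finset.sum_range_succ, Nat.factorial] at h4
          nlinarith
        linarith

lemma growth (α β C δ : ℝ) (hα : 0 < α) (hβ : 0 < β) (hC : 0 ≤ C) (hδ : 0 < δ) :
    ∃ M : ℝ, ∀ d : ℕ, 0 < d → ∀ ε ∈ Set.Ioo (0:ℝ) 1, M ≤ ε⁻¹ + d →
      C * (1 + Real.log ε⁻¹ + (d:ℝ) ^ (β / 2)) < δ * (ε ^ (-α) + (d:ℝ) ^ β) := by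
  set C' := C * (1 + 2 / α) with hC'
  have hC'0 : 0 ≤ C' := by positivity
  set R := 4 * C' / δ + 1 with hR
  have hR0 : 0 < R := by positivity
  refine ⟨2 * max (R ^ (2 / α)) (R ^ (2 / β)), fun d hd ε hε hM => ?_⟩
  have ht : 1 ≤ ε⁻¹ := (one_le_inv₀ hε.1).2 hε.2.le
  have hd1 : (1:ℝ) ≤ d := by exact_mod_cast hd
  have hεt : ε ^ (-α) = ε⁻¹ ^ α := by rw [Real.rpow_neg hε.1.le, Real.inv_rpow hε.1.le]
  rw [hεt]
  set t := ε⁻¹ with htt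
  set y := t ^ (α / 2) with hy
  set z := (d:ℝ) ^ (β / 2) with hz
  have hy1 : 1 ≤ y := Real.one_le_rpow ht (by positivity)
  have hz1 : 1 ≤ z := Real.one_le_rpow hd1 (by positivity)
  have hy2 : t ^ α = y ^ 2 := by
    rw [hy, ← Real.rpow_natCast, ← Real.rpow_mul (by linarith)]; congr 1; push_cast; ring
  have hz2 : (d:ℝ) ^ β = z ^ 2 := by
    rw [hz, ← Real.rpow_natCast, ← Real.rpow_mul (by linarith)]; congr 1; push_cast; ring
  have hlog : Real.log t ≤ 2 / α * y := by
    have := Real.log_le_rpow_div (x := t) (by linarith) (ε := α / 2) (by positivity)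
    calc _ ≤ _ := this
      _ = _ := by rw [hy]; field_simp
  have hyz : R ≤ y + z := by
    have h0 : max (R ^ (2 / α)) (R ^ (2 / β)) ≤ t ∨ max (R ^ (2 / α)) (R ^ (2 / β)) ≤ d := by
      by_contra! h; linarith [h.1, h.2]
    rcases h0 with h0 | h0
    · have h1 : R ^ (2 / α) ≤ t := (le_max_left _ _).trans h0
      have h2 : (R ^ (2 / α)) ^ (α / 2) ≤ y := Real.rpow_le_rpow (by positivity) h1 (by positivity)
      rw [← Real.rpow_mul hR0.le] at h2
      have : 2 / α * (α / 2) = 1 := by field_simp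
      rw [this, Real.rpow_one] at h2
      linarith
    · have h1 : R ^ (2 / β) ≤ d := (le_max_right _ _).trans h0
      have h2 : (R ^ (2 / β)) ^ (β / 2) ≤ z := Real.rpow_le_rpow (by positivity) h1 (by positivity)
      rw [← Real.rpow_mul hR0.le] at h2
      have : 2 / β * (β / 2) = 1 := by field_simp
      rw [this, Real.rpow_one] at h2
      linarith
  rw [hy2, hz2]
  have h1 : C * (1 + Real.log t + z) ≤ C' * (1 + y + z) := by
    rw [hC', mul_assoc]
    apply mul_le_mul_of_nonneg_left _ hC
    have : 0 < 2 / α := by positivity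
    nlinarith
  have h2 : C' * (1 + y + z) ≤ C' * (2 * (y + z)) :=
    mul_le_mul_of_nonneg_left (by linarith) hC'0
  have h3 : 4 * C' < δ * (y + z) := by
    have : δ * R ≤ δ * (y + z) := mul_le_mul_of_nonneg_left hyz hδ.le
    have h4 : δ * R = 4 * C' + δ := by rw [hR]; field_simp
    linarith
  have h5 : (y + z) * (4 * C') < (y + z) * (δ * (y + z)) :=
    mul_lt_mul_of_pos_left h3 (by linarith)
  have h6 : 0 ≤ δ * (y - z) ^ 2 := by positivity
  nlinarith

lemma decay (w : ℝ) (hw : w ∈ Set.Ioo (0:ℝ) 1) (a : ℕ → ℝ) (ha : ∀ j, 1 ≤ j → 0 < a j)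
    (hlim : ((1 / Real.log w⁻¹ : ℝ) : EReal) ≤
        Filter.liminf (fun j : ℕ => ((a j / Real.log j : ℝ) : EReal)) Filter.atTop)
    (δ : ℝ) (hδ : 0 < δ) (hδ1 : δ ≤ 1 / 4) :
    ∃ C ≥ (0:ℝ), ∀ j : ℕ, 1 ≤ j → w ^ ((1 - δ) * a j) ≤ C * (j:ℝ) ^ (-1 + 2 * δ) := by
  have hL : 0 < Real.log w⁻¹ := Real.log_pos ((one_lt_inv₀ hw.1).2 hw.2)
  set L := Real.log w⁻¹ with hLdef
  have hlt : (((1 - δ) / L : ℝ) : EReal) < Filter.liminf (fun j : ℕ => ((a j / Real.log j : ℝ) : EReal)) Filter.atTop := by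
    refine lt_of_lt_of_le ?_ hlim
    rw [EReal.coe_lt_coe_iff]
    gcongr; linarith
  obtain ⟨J, hJ⟩ := Filter.eventually_atTop.1 (eventually_lt_of_lt_liminf hlt)
  refine ⟨(J:ℝ) + 2, by positivity, fun j hj => ?_⟩
  have hj1 : (1:ℝ) ≤ j := by exact_mod_cast hj
  have hj0 : (0:ℝ) < j := by linarith
  by_cases hjJ : J + 2 ≤ j
  · have h1 := hJ j (by omega)
    rw [EReal.coe_lt_coe_iff] at h1
    have hlogj : 0 < Real.log j := Real.log_pos (by exact_mod_cast (by omega : 1 < j))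
    rw [div_lt_div_iff₀ hL hlogj] at h1
    have h2 : w ^ ((1 - δ) * a j) ≤ (j:ℝ) ^ (-1 + 2 * δ) := by
      rw [Real.rpow_def_of_pos hw.1, Real.rpow_def_of_pos hj0]
      apply Real.exp_le_exp.2
      have h3 : Real.log w = -L := by rw [hLdef, Real.log_inv]; ring
      rw [h3]
      have h4 : (1 - δ) * ((1 - δ) * Real.log j) ≤ (1 - δ) * (a j * L) :=
        mul_le_mul_of_nonneg_left h1.le (by linarith)
      have : 0 ≤ δ ^ 2 * Real.log j := by positivity
      nlinarith
    refine h2.trans ?_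
    have h5 : 0 ≤ (j:ℝ) ^ (-1 + 2 * δ) := Real.rpow_nonneg hj0.le _
    have : (0:ℝ) ≤ J := by positivity
    nlinarith
  · have h1 : w ^ ((1 - δ) * a j) ≤ 1 :=
      Real.rpow_le_one hw.1.le hw.2.le (mul_nonneg (by linarith) (ha j hj).le)
    refine h1.trans ?_
    have h2 : (j:ℝ) ^ (-1:ℝ) ≤ (j:ℝ) ^ (-1 + 2 * δ) :=
      Real.rpow_le_rpow_of_exponent_le hj1 (by linarith)
    rw [Real.rpow_neg_one] at h2
    have h3 : (j:ℝ) ≤ J + 2 := by exact_mod_cast (by omega : j ≤ J + 2)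
    calc (1:ℝ) = j * (j:ℝ)⁻¹ := by field_simp
      _ ≤ (J + 2) * (j:ℝ) ^ (-1 + 2 * δ) := by gcongr

lemma decay_sum (w : ℝ) (hw : w ∈ Set.Ioo (0:ℝ) 1) (a : ℕ → ℝ) (ha : ∀ j, 1 ≤ j → 0 < a j)
    (hlim : ((1 / Real.log w⁻¹ : ℝ) : EReal) ≤
        Filter.liminf (fun j : ℕ => ((a j / Real.log j : ℝ) : EReal)) Filter.atTop)
    (δ : ℝ) (hδ : 0 < δ) (hδ1 : δ ≤ 1 / 4) :
    ∃ C ≥ (0:ℝ), ∀ d : ℕ, ∑ j : Fin d, w ^ ((1 - δ) * a (j.1 + 1)) ≤ C * (d:ℝ) ^ (3 * δ) := by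
  obtain ⟨C, hC, H⟩ := decay w hw a ha hlim δ hδ hδ1
  have hs : Summable fun j : ℕ => (((j + 1 : ℕ)):ℝ) ^ (-1 - δ) :=
    (summable_nat_add_iff 1).2 (Real.summable_nat_rpow.2 (by linarith))
  refine ⟨C * ∑' j : ℕ, (((j + 1 : ℕ)):ℝ) ^ (-1 - δ),
    mul_nonneg hC (tsum_nonneg fun j => Real.rpow_nonneg (by positivity) _), fun d => ?_⟩
  calc ∑ j : Fin d, w ^ ((1 - δ) * a (j.1 + 1))
      ≤ ∑ j : Fin d, C * ((((j.1 + 1 : ℕ)):ℝ) ^ (-1 - δ)) * (d:ℝ) ^ (3 * δ) := by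
        refine Finset.sum_le_sum fun j _ => (H (j.1 + 1) (by omega)).trans ?_
        have h0 : (0:ℝ) < ((j.1 + 1 : ℕ) : ℝ) := by positivity
        have h1 : (((j.1 + 1 : ℕ)):ℝ) ^ (-1 + 2 * δ) =
            (((j.1 + 1 : ℕ)):ℝ) ^ (-1 - δ) * (((j.1 + 1 : ℕ)):ℝ) ^ (3 * δ) := by
          rw [← Real.rpow_add h0]; congr 1; ring
        rw [h1, mul_assoc]
        have h2 : ((j.1 + 1 : ℕ) : ℝ) ≤ d := by exact_mod_cast j.2
        gcongr
    _ = C * (∑ j : Fin d, (((j.1 + 1 : ℕ)):ℝ) ^ (-1 - δ)) * (d:ℝ) ^ (3 * δ) := by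
        rw [Finset.mul_sum, Finset.sum_mul]
    _ ≤ _ := by
        gcongr
        rw [Fin.sum_univ_eq_sum_range (fun j => (((j + 1 : ℕ)):ℝ) ^ (-1 - δ)) d]
        exact hs.sum_le_tsum _ (fun _ _ => Real.rpow_nonneg (by positivity) _)

lemma one_le_CRI {d : ℕ} (ω : (Fin d → ℤ) → ℝ) (h0 : ω 0 = 1) (crit : Crit) : 1 ≤ CRI ω crit := by
  cases crit
  · exact le_rfl
  · exact one_le_initErr ω h0

lemma CRI_le {d : ℕ} (ω : (Fin d → ℤ) → ℝ) (hc : Summable fun h => (ω h)⁻¹ ^ 2)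
    (h1 : 1 ≤ ∑' h, (ω h)⁻¹ ^ 2) (crit : Crit) :
    CRI ω crit ≤ ENNReal.ofReal (√(∑' h, (ω h)⁻¹ ^ 2)) := by
  cases crit
  · change (1:ℝ≥0∞) ≤ _
    rw [← ENNReal.ofReal_one]
    exact ENNReal.ofReal_le_ofReal (by rw [Real.one_le_sqrt]; exact h1)
  · exact initErr_le ω hc

lemma mem_of_std {d : ℕ} (ω : (Fin d → ℤ) → ℝ) (hc : Summable fun h => (ω h)⁻¹ ^ 2)
    (h0 : ω 0 = 1) (crit : Crit) (useStd : Bool) (ε : ℝ) (n : ℕ)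
    (hn : wcErr ω (stdInfo ω) n ≤ ENNReal.ofReal ε) :
    wcErr ω (if useStd then stdInfo ω else allInfo d) n ≤ ENNReal.ofReal ε * CRI ω crit := by
  have h1 : wcErr ω (if useStd then stdInfo ω else allInfo d) n ≤ wcErr ω (stdInfo ω) n := by
    apply wcErr_mono
    cases useStd
    · simpa using std_subset_all ω hc
    · simp
  refine h1.trans (hn.trans ?_)
  exact le_mul_of_one_le_right (zero_le) (one_le_CRI ω h0 crit)

lemma nc_lower {d : ℕ} (ω : (Fin d → ℤ) → ℝ) (hω : ∀ h, 1 ≤ ω h)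
    (hc : Summable fun h => (ω h)⁻¹ ^ 2)
    (h1 : 1 ≤ ∑' h, (ω h)⁻¹ ^ 2) (crit : Crit) (useStd : Bool) (n : ℕ)
    (hn : wcErr ω (if useStd then stdInfo ω else allInfo d) n ≤ ENNReal.ofReal (1/2) * CRI ω crit) :
    3 / 4 * ∑' h, (ω h)⁻¹ ^ 2 ≤ n := by
  set S := ∑' h, (ω h)⁻¹ ^ 2 with hS
  have h2 : wcErr ω (allInfo d) n ≤ wcErr ω (if useStd then stdInfo ω else allInfo d) n := by
    apply wcErr_mono
    cases useStd
    · simp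
    · simpa using std_subset_all ω hc
  have h3 : wcErr ω (allInfo d) n ≤ ENNReal.ofReal (1 / 2 * √S) := by
    rw [ENNReal.ofReal_mul (by norm_num)]
    exact h2.trans (hn.trans (mul_le_mul_right (CRI_le ω hc h1 crit) _))
  have h4 : ∀ A : Finset (Fin d → ℤ), ∑ h ∈ A, (ω h)⁻¹ ^ 2 ≤ n + S / 4 := by
    intro A
    have h5 := (lower_all ω hω A n).trans h3
    rw [ENNReal.ofReal_le_ofReal_iff (by positivity), Real.sqrt_le_left (by positivity), mul_pow,
      Real.sq_sqrt (by linarith)] at h5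
    linarith
  have h6 : S ≤ n + S / 4 := hc.tsum_le_of_sum_le h4
  linarith

/-- For the Korobov spaces with exponential weight, for either
information class and either error criterion,
ALG-UWT ⟺ `liminf_j a_j / ln j ≥ 1 / ln ω⁻¹`. -/
theorem stmt17
    (w : ℝ) (hw : w ∈ Set.Ioo (0:ℝ) 1)
    (a b : ℕ → ℝ)
    (hapos : 0 < a 1) (hamono : ∀ j, 1 ≤ j → a j ≤ a (j + 1))
    (hb : ∃ c > (0:ℝ), ∀ j, 1 ≤ j → c ≤ b j)
    (crit : Crit) (useStd : Bool) :
    ALGUWT (expKorNC w a b useStd crit) ↔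
      ((1 / Real.log w⁻¹ : ℝ) : EReal) ≤
        Filter.liminf (fun j : ℕ => ((a j / Real.log j : ℝ) : EReal)) Filter.atTop := by
  have hL : 0 < Real.log w⁻¹ := Real.log_pos ((one_lt_inv₀ hw.1).2 hw.2)
  have hmono : ∀ i j, 1 ≤ i → i ≤ j → a i ≤ a j := by
    intro i j hi hij
    induction j, hij using Nat.le_induction with
    | base => exact le_rfl
    | succ k hk ih => exact ih.trans (hamono k (hi.trans hk))
  have hmono1 : ∀ j, 1 ≤ j → a 1 ≤ a j := fun j hj => hmono 1 j le_rfl hj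
  have ha : ∀ j, 1 ≤ j → 0 < a j := fun j hj => hapos.trans_le (hmono1 j hj)
  have hb0 : ∀ j, 1 ≤ j → 0 < b j := by
    obtain ⟨c, hc, h⟩ := hb
    exact fun j hj => hc.trans_le (h j hj)
  have hω := kor_ge_one w hw a b ha
  have h0 := kor_zero w a b hb0
  have hsum : ∀ d, Summable fun h => (expKorWeight w a b d h)⁻¹ ^ 2 := by
    intro d
    obtain ⟨D, hD, H⟩ := kor_sum w hw a b hapos hmono1 hb 1 one_pos
    refine summable_of_sum_le (fun h => sq_nonneg _) (fun F => ?_)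
      (c := Real.exp (D * ∑ j : Fin d, w ^ (1 * a (j.1 + 1))))
    simpa only [Real.rpow_one] using H d F
  -- general upper bound
  have upper : ∀ p, 0 < p → p < 1 → ∃ D ≥ (0:ℝ), ∀ d : ℕ, ∀ ε ∈ Set.Ioo (0:ℝ) 1,
      ∃ n : ℕ, wcErr (expKorWeight w a b d) (if useStd then stdInfo (expKorWeight w a b d)
          else allInfo d) n ≤ ENNReal.ofReal ε * CRI (expKorWeight w a b d) crit ∧
        (n : ℝ) ≤ (4 * Real.exp (D * ∑ j : Fin d, w ^ (p * a (j.1 + 1))) / ε ^ 2)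
          ^ (2 + p / (1 - p)) := by
    intro p hp0 hp1
    obtain ⟨D, hD, H⟩ := kor_sum w hw a b hapos hmono1 hb p hp0
    refine ⟨D, hD, fun d ε hε => ?_⟩
    obtain ⟨n, hn1, hn2⟩ := upper_general (expKorWeight w a b d) (hω d) p
      (Real.exp (D * ∑ j : Fin d, w ^ (p * a (j.1 + 1)))) hp0 hp1
      (Real.one_le_exp (mul_nonneg hD (Finset.sum_nonneg fun j _ => Real.rpow_nonneg hw.1.le _)))
      (H d) ε hε.1 hε.2
    exact ⟨n, mem_of_std _ (hsum d) (h0 d) crit useStd ε n hn1, hn2⟩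
  constructor
  · intro hU
    by_contra! hcon
    obtain ⟨x, hx1, hx2⟩ := EReal.lt_iff_exists_real_btwn.1 hcon
    rw [EReal.coe_lt_coe_iff, lt_div_iff₀ hL] at hx2
    have hfreq := frequently_lt_of_liminf_lt (by isBoundedDefault) hx1
    set L := Real.log w⁻¹ with hLdef
    set β := (1 - x * L) / 2 with hβ
    have hβ0 : 0 < β := by rw [hβ]; linarith
    obtain ⟨M, hM⟩ := hU 1 one_pos β hβ0 1 one_pos
    apply hfreq
    have hlogt : Tendsto (fun d : ℕ => Real.log d) atTop atTop :=
      Real.tendsto_log_atTop.comp tendsto_natCast_atTop_atTop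
    filter_upwards [eventually_ge_atTop 2, eventually_ge_atTop ⌈M⌉₊,
      hlogt.eventually_ge_atTop (Real.log 4 / β)] with d hd2 hdM hdlog
    rw [EReal.coe_lt_coe_iff, not_lt]
    have hd1 : (1:ℝ) < d := by exact_mod_cast (by omega : 1 < d)
    have hdpos : (0:ℝ) < d := by linarith
    have hlogd : 0 < Real.log d := Real.log_pos hd1
    have hMd : M ≤ d := Nat.ceil_le.1 hdM
    have h1 := hM d (by omega) (1/2) (by constructor <;> norm_num) (by norm_num; linarith)
    set N := expKorNC w a b useStd crit d (1/2) with hN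
    have h2 : ((1/2:ℝ)) ^ (-(1:ℝ)) = 2 := by rw [Real.rpow_neg_one]; norm_num
    have hdβ : 1 ≤ (d:ℝ) ^ β := Real.one_le_rpow hd1.le hβ0.le
    beta_reduce at h1
    rw [h2, abs_lt, div_lt_one (by linarith)] at h1
    have h3 := h1.2
    have hmem : wcErr (expKorWeight w a b d) (if useStd then stdInfo (expKorWeight w a b d)
          else allInfo d) N ≤ ENNReal.ofReal (1/2) * CRI (expKorWeight w a b d) crit := by
      obtain ⟨D, -, H⟩ := upper (1/2) (by norm_num) (by norm_num)
      obtain ⟨n, hn, -⟩ := H d (1/2) (by constructor <;> norm_num)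
      exact Nat.sInf_mem (s := {n : ℕ | wcErr (expKorWeight w a b d)
        (if useStd then stdInfo (expKorWeight w a b d) else allInfo d) n
          ≤ ENNReal.ofReal (1/2) * CRI (expKorWeight w a b d) crit}) ⟨n, hn⟩
    have hS := kor_lower w hw a b hmono hapos hb0 d (hsum d)
    have hwa : 0 < w ^ a d := Real.rpow_pos_of_pos hw.1 _
    have hS1 : 1 ≤ ∑' h, (expKorWeight w a b d h)⁻¹ ^ 2 :=
      (Real.one_le_exp (by positivity)).trans hS
    have h4 := nc_lower _ (hω d) (hsum d) hS1 crit useStd N hmem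
    have h5 : 3 / 4 * Real.exp (d * w ^ a d) ≤ N := by linarith
    have h6 := Real.log_le_log (by positivity) h5
    rw [Real.log_mul (by norm_num) (Real.exp_pos _).ne', Real.log_exp] at h6
    have h7 : -1 ≤ Real.log (3/4) := by
      have := Real.one_sub_inv_le_log_of_pos (x := 3/4) (by norm_num)
      norm_num at this ⊢; linarith
    have h8 : d * w ^ a d ≤ 4 * (d:ℝ) ^ β := by linarith
    have h9 := Real.log_le_log (by positivity) h8
    rw [Real.log_mul hdpos.ne' hwa.ne', Real.log_mul (by norm_num) (by positivity),
      Real.log_rpow hw.1, Real.log_rpow hdpos] at h9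
    have h10 : Real.log w = -L := by rw [hLdef, Real.log_inv]; ring
    rw [h10] at h9
    rw [div_le_iff₀ hβ0] at hdlog
    rw [le_div_iff₀ hlogd]
    have h11 : x * L = 1 - 2 * β := by rw [hβ]; ring
    have h12 : x * Real.log d * L ≤ a d * L := by
      have : x * Real.log d * L = (1 - 2 * β) * Real.log d := by rw [← h11]; ring
      rw [this]; nlinarith
    exact le_of_mul_le_mul_right h12 hL
  · intro hlim α hα β hβ δ hδ
    set δ₀ := min (β / 6) (1 / 4) with hδ₀
    have hδ0 : 0 < δ₀ := lt_min (by positivity) (by norm_num)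
    have hδ1 : δ₀ ≤ 1 / 4 := min_le_right _ _
    have hδβ : 3 * δ₀ ≤ β / 2 := by have := min_le_left (β / 6) (1 / 4); linarith
    obtain ⟨C, hC, hCs⟩ := decay_sum w hw a ha hlim δ₀ hδ0 hδ1
    obtain ⟨D, hD, H⟩ := upper (1 - δ₀) (by linarith) (by linarith)
    set q := 2 + (1 - δ₀) / (1 - (1 - δ₀)) with hq
    have hq0 : 0 < q := by
      have : 0 < (1 - δ₀) / (1 - (1 - δ₀)) := div_pos (by linarith) (by linarith)
      linarith
    obtain ⟨M, hM⟩ := growth α β (q * (2 + D * C)) δ hα hβ (by positivity) hδ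
    refine ⟨M, fun d hd ε hε hMd => ?_⟩
    have hg := hM d hd ε hε hMd
    obtain ⟨n, hn1, hn2⟩ := H d ε hε
    set N := expKorNC w a b useStd crit d ε with hN
    have hNn : N ≤ n := Nat.sInf_le hn1
    have hd1 : (1:ℝ) ≤ d := by exact_mod_cast hd
    have hden : 0 < ε ^ (-α) + (d:ℝ) ^ β := by
      have := Real.rpow_pos_of_pos hε.1 (-α)
      positivity
    have hlogε : 0 ≤ Real.log ε⁻¹ := Real.log_nonneg ((one_le_inv₀ hε.1).2 hε.2.le)
    have hdz : 0 ≤ (d:ℝ) ^ (β / 2) := by positivity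
    have hlogN : Real.log N ≤ q * (2 + D * C) * (1 + Real.log ε⁻¹ + (d:ℝ) ^ (β / 2)) := by
      by_cases hN0 : N = 0
      · rw [hN0]; simp only [Nat.cast_zero, Real.log_zero]; positivity
      have hNpos : (0:ℝ) < N := by exact_mod_cast Nat.pos_of_ne_zero hN0
      have h1 : (N:ℝ) ≤ n := by exact_mod_cast hNn
      have h2 := Real.log_le_log hNpos (h1.trans hn2)
      have hε2 : 0 < ε ^ 2 := pow_pos hε.1 2
      rw [Real.log_rpow (by positivity), Real.log_div (by positivity) hε2.ne',
        Real.log_mul (by norm_num) (Real.exp_pos _).ne', Real.log_exp, Real.log_pow] at h2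
      refine h2.trans ?_
      rw [mul_assoc]
      apply mul_le_mul_of_nonneg_left _ hq0.le
      have h3 : Real.log 4 ≤ 2 := by
        have : Real.log 4 = 2 * Real.log 2 := by
          rw [show (4:ℝ) = 2 ^ 2 by norm_num, Real.log_pow]; norm_num
        have := Real.log_two_lt_d9
        linarith
      have h4 : D * ∑ j : Fin d, w ^ ((1 - δ₀) * a (j.1 + 1)) ≤ D * (C * (d:ℝ) ^ (β / 2)) := by
        refine mul_le_mul_of_nonneg_left ((hCs d).trans ?_) hD
        exact mul_le_mul_of_nonneg_left (Real.rpow_le_rpow_of_exponent_le hd1 hδβ) hC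
      have h5 : Real.log ε = - Real.log ε⁻¹ := by rw [Real.log_inv]; ring
      rw [h5]
      push_cast
      have h6 : 0 ≤ D * C := by positivity
      nlinarith [mul_nonneg h6 hlogε]
    rw [abs_of_nonneg (div_nonneg (Real.log_natCast_nonneg _) hden.le), div_lt_iff₀ hden]
    linarith
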